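/- Let U(Λ₁), U(Λ₂) be unitary m×m matrices arising as Cayley transforms of Lagrangian frames. Then dim ker(U(Λ₂)^{-1}U(Λ₁) - I) equals the dimension of the intersection of the corresponding Lagrangian subspaces. Concretely: if Λ_j is the column space of the frame [X_j; Y_j] with X_j*Y_j = Y_j*X_j and rank m, and U_j = (X_j + iY_j)(X_j - iY_j)^{-1}, then dim(Λ₁ ∩ Λ₂) = dim ker(U₂^{-1}U₁ - I). -/

import Mathlib

open Matrix

open scoped ComplexOrder in
/-- A Lagrangian frame `[X; Y]` and `X + cY`, for `c = ± i`, have the same rank. -/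
lemma rank_add_smul_eq_rank_fromRows {n : Type*} [Fintype n] {c : ℂ}
    (hc : star c = -c) (hcc : c * c = -1) {X Y : Matrix n n ℂ} (h : Xᴴ * Y = Yᴴ * X) :
    (X + c • Y).rank = (Matrix.fromRows X Y).rank := by
  have key : (X + c • Y)ᴴ * (X + c • Y) = (Matrix.fromRows X Y)ᴴ * Matrix.fromRows X Y := by
    rw [conjTranspose_fromRows_eq_fromCols_conjTranspose, fromCols_mul_fromRows,
      conjTranspose_add, conjTranspose_smul, hc]
    simp only [add_mul, mul_add, Matrix.smul_mul, Matrix.mul_smul, smul_smul, h, neg_mul, neg_smul, hcc,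
      one_smul, neg_neg]
    abel
  rw [← rank_conjTranspose_mul_self, key, rank_conjTranspose_mul_self]

lemma isUnit_det_of_rank_eq_card {n K : Type*} [Fintype n] [DecidableEq n] [Field K]
    {A : Matrix n n K} (h : A.rank = Fintype.card n) : IsUnit A.det := by
  rw [← isUnit_iff_isUnit_det, ← mulVec_surjective_iff_isUnit]
  have htop : LinearMap.range A.mulVecLin = ⊤ :=
    Submodule.eq_top_of_finrank_eq (h.trans (Module.finrank_fintype_fun_eq_card K).symm)
  exact LinearMap.range_eq_top.mp htop

/-- Over a field, `(U₂⁻¹ U₁ - 1) w = 0` for invertible `U₂` says that `U₁ w = U₂ w`. -/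
lemma mem_ker_inv_mul_sub_one_iff {n K : Type*} [Fintype n] [DecidableEq n] [Field K]
    {U V : Matrix n n K} (hV : IsUnit V.det) (w : n → K) :
    w ∈ LinearMap.ker (V⁻¹ * U - 1).mulVecLin ↔ U *ᵥ w = V *ᵥ w := by
  rw [LinearMap.mem_ker, mulVecLin_apply, sub_mulVec, one_mulVec, sub_eq_zero, ← mulVec_mulVec]
  constructor
  · intro h
    conv_rhs => rw [← h]
    rw [mulVec_mulVec, mulVec_mulVec, mul_nonsing_inv _ hV, one_mul]
  · intro h
    rw [h, mulVec_mulVec, nonsing_inv_mul _ hV, one_mulVec]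

/-- The dimension of the intersection of two Lagrangian subspaces (given as column spaces of
Lagrangian frames `[X_j; Y_j]`) equals the dimension of `ker(U₂⁻¹ U₁ - I)` where
`U_j = (X_j + iY_j)(X_j - iY_j)⁻¹` are the corresponding Cayley transforms. -/
theorem lagrangian_intersection_dim_eq_ker_dim (m : ℕ)
    (X₁ Y₁ X₂ Y₂ : Matrix (Fin m) (Fin m) ℂ)
    (h₁ : X₁ᴴ * Y₁ = Y₁ᴴ * X₁) (h₂ : X₂ᴴ * Y₂ = Y₂ᴴ * X₂)
    (hr₁ : (Matrix.fromRows X₁ Y₁).rank = m) (hr₂ : (Matrix.fromRows X₂ Y₂).rank = m) :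
    Module.finrank ℂ
      ↥(LinearMap.range (Matrix.mulVecLin (Matrix.fromRows X₁ Y₁)) ⊓
        LinearMap.range (Matrix.mulVecLin (Matrix.fromRows X₂ Y₂))) =
    Module.finrank ℂ
      ↥(LinearMap.ker (Matrix.mulVecLin
        (((X₂ + Complex.I • Y₂) * (X₂ - Complex.I • Y₂)⁻¹)⁻¹ *
          ((X₁ + Complex.I • Y₁) * (X₁ - Complex.I • Y₁)⁻¹) - 1))) := by
  have unit_add {X Y : Matrix (Fin m) (Fin m) ℂ} (h : Xᴴ * Y = Yᴴ * X)
      (hr : (Matrix.fromRows X Y).rank = m) : IsUnit (X + Complex.I • Y).det :=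
    isUnit_det_of_rank_eq_card <| by
      rw [rank_add_smul_eq_rank_fromRows (by simp) (by simp) h, hr, Fintype.card_fin]
  have unit_sub {X Y : Matrix (Fin m) (Fin m) ℂ} (h : Xᴴ * Y = Yᴴ * X)
      (hr : (Matrix.fromRows X Y).rank = m) : IsUnit (X - Complex.I • Y).det :=
    isUnit_det_of_rank_eq_card <| by
      rw [sub_eq_add_neg, ← neg_smul, rank_add_smul_eq_rank_fromRows (by simp) (by simp) h, hr,
        Fintype.card_fin]
  have hB₁ := unit_sub h₁ hr₁
  have hB₂ := unit_sub h₂ hr₂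
  have hU₂ : IsUnit ((X₂ + Complex.I • Y₂) * (X₂ - Complex.I • Y₂)⁻¹).det := by
    rw [det_mul]
    exact (unit_add h₂ hr₂).mul (isUnit_nonsing_inv_det _ hB₂)
  have hinj : Function.Injective
      (Matrix.fromRows X₁ Y₁ * (X₁ - Complex.I • Y₁)⁻¹).mulVecLin := by
    rw [← LinearMap.ker_eq_bot, LinearMap.ker_eq_bot']
    intro w hw
    obtain ⟨a, rfl⟩ := (mulVec_surjective_iff_isUnit.mpr
      ((isUnit_iff_isUnit_det _).mpr hB₁)) w
    rw [mulVecLin_apply, mulVec_mulVec, nonsing_inv_mul_cancel_right _ _ hB₁,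
      fromRows_mulVec] at hw
    have hX : X₁ *ᵥ a = 0 := funext fun i => congrFun hw (Sum.inl i)
    have hY : Y₁ *ᵥ a = 0 := funext fun i => congrFun hw (Sum.inr i)
    simp [sub_mulVec, smul_mulVec, hX, hY]
  rw [(Submodule.equivMapOfInjective _ hinj _).finrank_eq]
  refine congrArg (fun S : Submodule ℂ (Fin m ⊕ Fin m → ℂ) => Module.finrank ℂ S) ?_
  ext z
  simp only [Submodule.mem_inf, LinearMap.mem_range, Submodule.mem_map,
    mem_ker_inv_mul_sub_one_iff hU₂]
  constructor
  · rintro ⟨⟨a, rfl⟩, b, hb⟩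
    simp only [mulVecLin_apply, fromRows_mulVec] at hb
    have hX : X₂ *ᵥ b = X₁ *ᵥ a := funext fun i => congrFun hb (Sum.inl i)
    have hY : Y₂ *ᵥ b = Y₁ *ᵥ a := funext fun i => congrFun hb (Sum.inr i)
    have hw : (X₁ - Complex.I • Y₁) *ᵥ a = (X₂ - Complex.I • Y₂) *ᵥ b := by
      simp only [sub_mulVec, smul_mulVec, hX, hY]
    refine ⟨(X₁ - Complex.I • Y₁) *ᵥ a, ?_, ?_⟩
    · rw [mulVec_mulVec, nonsing_inv_mul_cancel_right _ _ hB₁, hw, mulVec_mulVec,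
        nonsing_inv_mul_cancel_right _ _ hB₂]
      simp only [add_mulVec, smul_mulVec, hX, hY]
    · rw [mulVecLin_apply, mulVec_mulVec, nonsing_inv_mul_cancel_right _ _ hB₁, mulVecLin_apply]
  · rintro ⟨w, hw, rfl⟩
    obtain ⟨a, ha⟩ := (mulVec_surjective_iff_isUnit.mpr
      ((isUnit_iff_isUnit_det _).mpr hB₁)) w
    obtain ⟨b, hb⟩ := (mulVec_surjective_iff_isUnit.mpr
      ((isUnit_iff_isUnit_det _).mpr hB₂)) w
    have hsub := ha.trans hb.symm
    have hadd : (X₁ + Complex.I • Y₁) *ᵥ a = (X₂ + Complex.I • Y₂) *ᵥ b := by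
      nth_rewrite 1 [← ha] at hw
      rw [← hb, mulVec_mulVec, nonsing_inv_mul_cancel_right _ _ hB₁, mulVec_mulVec,
        nonsing_inv_mul_cancel_right _ _ hB₂] at hw
      exact hw
    simp only [add_mulVec, sub_mulVec, smul_mulVec] at hadd hsub
    have hX : X₂ *ᵥ b = X₁ *ᵥ a := by
      ext i
      have e₁ := congrFun hadd i
      have e₂ := congrFun hsub i
      simp only [Pi.add_apply, Pi.sub_apply] at e₁ e₂
      linear_combination (-1 / 2 : ℂ) * (e₁ + e₂)
    have hY : Y₂ *ᵥ b = Y₁ *ᵥ a := by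
      rw [hX] at hadd
      exact (smul_right_injective _ Complex.I_ne_zero (add_left_cancel hadd)).symm
    refine ⟨⟨a, ?_⟩, b, ?_⟩
    · rw [← ha, mulVecLin_apply, mulVecLin_apply, mulVec_mulVec,
        nonsing_inv_mul_cancel_right _ _ hB₁]
    · rw [← ha, mulVecLin_apply, mulVecLin_apply, mulVec_mulVec,
        nonsing_inv_mul_cancel_right _ _ hB₁, fromRows_mulVec, fromRows_mulVec, hX, hY]
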